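/- Let X be a finite nonempty set and M : X × X → [0, 1] symmetric, i.e., M(x, y) + M(y, x) = 1 for all x, y ∈ X. With U(p, q) = Σ_{x,y} p(x)·q(y)·M(x, y) and DGap(p, q) = max_{p'} U(p', q) − min_{q'} U(p, q'), the following hold for all probability distributions p, q on X: DGap(p, p) = 2·max_{p'} U(p', p) − 1, and DGap(p, p) ≤ 2·DGap(p, q). -/

import Mathlib

/-- The expected winning probability of distribution `p` against `q` under the
preference function `M`. -/
def gameU {X : Type*} [Fintype X] (M : X → X → ℝ) (p q : X → ℝ) : ℝ :=
  ∑ x, ∑ y, p x * q y * M x y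

/-- The duality gap of the pair `(p, q)` in the preference game given by `M`:
`max_{p'} U(p', q) − min_{q'} U(p, q')`, the max/min ranging over all
probability distributions on `X`. -/
noncomputable def dGap {X : Type*} [Fintype X] (M : X → X → ℝ) (p q : X → ℝ) : ℝ :=
  sSup ((fun p' => gameU M p' q) '' stdSimplex ℝ X)
    - sInf ((fun q' => gameU M p q') '' stdSimplex ℝ X)

lemma gameU_add_gameU_swap {X : Type*} [Fintype X] {M : X → X → ℝ}
    (hsym : ∀ x y, M x y + M y x = 1) {p q : X → ℝ}
    (hp : p ∈ stdSimplex ℝ X) (hq : q ∈ stdSimplex ℝ X) :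
    gameU M p q + gameU M q p = 1 := by
  unfold gameU
  rw [Finset.sum_comm (f := fun x y => q x * p y * M x y), ← Finset.sum_add_distrib]
  calc ∑ x, (∑ y, p x * q y * M x y + ∑ y, q y * p x * M y x)
      = ∑ x, ∑ y, p x * q y := by
        refine Finset.sum_congr rfl fun x _ => ?_
        rw [← Finset.sum_add_distrib]
        refine Finset.sum_congr rfl fun y _ => ?_
        linear_combination p x * q y * hsym x y
    _ = 1 := by rw [← Finset.sum_mul_sum, hp.2, hq.2, one_mul]

lemma gameU_nonneg {X : Type*} [Fintype X] {M : X → X → ℝ}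
    (hM : ∀ x y, 0 ≤ M x y) {p q : X → ℝ}
    (hp : p ∈ stdSimplex ℝ X) (hq : q ∈ stdSimplex ℝ X) : 0 ≤ gameU M p q :=
  Finset.sum_nonneg fun x _ => Finset.sum_nonneg fun y _ =>
    mul_nonneg (mul_nonneg (hp.1 x) (hq.1 y)) (hM x y)

lemma isLUB_gameU {X : Type*} [Fintype X] {M : X → X → ℝ}
    (hM : ∀ x y, 0 ≤ M x y) (hsym : ∀ x y, M x y + M y x = 1) {q : X → ℝ}
    (hq : q ∈ stdSimplex ℝ X) :
    IsLUB ((fun p' => gameU M p' q) '' stdSimplex ℝ X)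
      (sSup ((fun p' => gameU M p' q) '' stdSimplex ℝ X)) := by
  refine isLUB_csSup ⟨_, q, hq, rfl⟩ ⟨1, ?_⟩
  rintro _ ⟨p, hp, rfl⟩
  linarith [gameU_add_gameU_swap hsym hp hq, gameU_nonneg hM hq hp]

lemma sInf_gameU {X : Type*} [Fintype X] {M : X → X → ℝ}
    (hM : ∀ x y, 0 ≤ M x y) (hsym : ∀ x y, M x y + M y x = 1) {p : X → ℝ}
    (hp : p ∈ stdSimplex ℝ X) :
    sInf ((fun q' => gameU M p q') '' stdSimplex ℝ X)
      = 1 - sSup ((fun p' => gameU M p' p) '' stdSimplex ℝ X) := by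
  have hS := isLUB_gameU hM hsym hp
  refine IsGLB.csInf_eq ⟨?_, fun b hb => ?_⟩ ⟨_, p, hp, rfl⟩
  · rintro _ ⟨q, hq, rfl⟩
    have hle := hS.1 ⟨q, hq, rfl⟩
    dsimp only at hle ⊢
    linarith [gameU_add_gameU_swap hsym hp hq]
  · rw [le_sub_comm]
    refine hS.2 ?_
    rintro _ ⟨q, hq, rfl⟩
    have hle := hb ⟨q, hq, rfl⟩
    dsimp only at hle ⊢
    linarith [gameU_add_gameU_swap hsym hp hq]

/-- For a symmetric preference function `M`, the duality gap of `(p, p)` equals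
`2·max_{p'} U(p', p) − 1`, and is at most `2·DGap(p, q)` for any `q`. -/
theorem stmt7 {X : Type*} [Fintype X] [Nonempty X] (M : X → X → ℝ)
    (hM : ∀ x y, M x y ∈ Set.Icc (0 : ℝ) 1)
    (hsym : ∀ x y, M x y + M y x = 1)
    (p q : X → ℝ) (hp : p ∈ stdSimplex ℝ X) (hq : q ∈ stdSimplex ℝ X) :
    dGap M p p = 2 * sSup ((fun p' => gameU M p' p) '' stdSimplex ℝ X) - 1 ∧
    dGap M p p ≤ 2 * dGap M p q := by
  have hM0 : ∀ x y, 0 ≤ M x y := fun x y => (hM x y).1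
  have hle := (isLUB_gameU hM0 hsym hq).1 ⟨q, hq, rfl⟩
  dsimp only at hle
  unfold dGap
  rw [sInf_gameU hM0 hsym hp]
  constructor <;> linarith [gameU_add_gameU_swap hsym hq hq]
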